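/- Let l ≥ 1 be an integer and b, c > 0 real. Let {z_j}_{j=1}^{l} be the (distinct) roots of p_l and {z̃_j}_{j=1}^{l+1} the (distinct) roots of q_l, and set β_l = l(l+1). Let φ : [0, ∞) → ℂ be continuously differentiable with φ(0) = 0, and define σ_l(t) = (c/b) ∑_{j=1}^{l} z_j e^{(c/b) z_j t} and ψ(t) = (σ_l ∗ φ)(t) − (b/c) φ′(t). Then for all t ≥ 0: (c/b) ∑_{j=1}^{l+1} ( z̃_j³/(z̃_j² + β_l) ) ∫₀^t e^{(c/b) z̃_j (t − τ)} ψ(τ) dτ + ψ(t) ∑_{j=1}^{l+1} z̃_j²/(z̃_j² + β_l) = ∑_{j=1}^{l} z_j ∫₀^t e^{(c/b) z_j (t − τ)} φ′(τ) dτ. (This is the time-domain identity (ρ_l ∗ ψ_l)(t) = (σ_l ∗ φ′)(t)-type relation used to validate the analytic formula for the NRBC kernel ρ_l against the known kernel σ_l.) -/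

import Mathlib

open Polynomial intervalIntegral

/-- The polynomial `p_l(z) = ∑_{k=0}^{l} ((l+k)! / (2^k k! (l−k)!)) z^{l−k}`. -/
noncomputable def pPoly (l : ℕ) : Polynomial ℂ :=
  ∑ k ∈ Finset.range (l + 1),
    C (((l + k).factorial : ℂ) / (2 ^ k * (k.factorial : ℂ) * ((l - k).factorial : ℂ))) *
      X ^ (l - k)

/-- The polynomial `q_l(z) = z p_l'(z) − (z + l) p_l(z)`. -/
noncomputable def qPoly (l : ℕ) : Polynomial ℂ :=
  X * derivative (pPoly l) - (X + C (l : ℂ)) * pPoly l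

theorem pPoly_coeff_of_lt {l m : ℕ} (h : l < m) : (pPoly l).coeff m = 0 := by
  simp only [pPoly, finsetSum_coeff, coeff_C_mul, coeff_X_pow]
  refine Finset.sum_eq_zero fun k _ => ?_
  rw [if_neg (by omega), mul_zero]

theorem pPoly_coeff_add (m n : ℕ) : (pPoly (m + n)).coeff m =
    ((m + 2 * n).factorial : ℂ) / (2 ^ n * (n.factorial : ℂ) * (m.factorial : ℂ)) := by
  simp only [pPoly, finsetSum_coeff, coeff_C_mul, coeff_X_pow]
  rw [Finset.sum_eq_single n]
  · rw [if_pos (by omega), mul_one, show m + n + n = m + 2 * n by ring,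
      show m + n - n = m by omega]
  · intro k hk hkn
    rw [Finset.mem_range] at hk
    rw [if_neg (by omega), mul_zero]
  · intro h
    exact absurd (Finset.mem_range.2 (by omega)) h

theorem pPoly_coeff_self (l : ℕ) : (pPoly l).coeff l = 1 := by
  have h := pPoly_coeff_add l 0
  simp only [add_zero, mul_zero] at h
  rw [h]
  have := Nat.cast_ne_zero (R := ℂ).2 l.factorial_ne_zero
  simp [this]

theorem pPoly_natDegree_le (l : ℕ) : (pPoly l).natDegree ≤ l :=
  natDegree_le_iff_coeff_eq_zero.2 fun _ h => pPoly_coeff_of_lt h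

theorem pPoly_eval_zero_ne_zero (l : ℕ) : (pPoly l).eval 0 ≠ 0 := by
  have h := pPoly_coeff_add 0 l
  rw [zero_add] at h
  rw [← coeff_zero_eq_eval_zero, h]
  simp [Nat.factorial_ne_zero]

theorem pPoly_coeff_succ (l m : ℕ) :
    ((m : ℂ) + 1) * (2 * l - m) * (pPoly l).coeff (m + 1) = 2 * (l - m) * (pPoly l).coeff m := by
  rcases lt_trichotomy m l with h | rfl | h
  · obtain ⟨n, rfl⟩ : ∃ n, l = m + (n + 1) := ⟨l - m - 1, by omega⟩
    rw [pPoly_coeff_add m (n + 1), show m + (n + 1) = (m + 1) + n by ring,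
      pPoly_coeff_add (m + 1) n, show m + 2 * (n + 1) = (m + 1 + 2 * n) + 1 by ring]
    simp only [Nat.factorial_succ (m + 1 + 2 * n), Nat.factorial_succ m, Nat.factorial_succ n]
    have h1 := Nat.cast_ne_zero (R := ℂ).2 m.factorial_ne_zero
    have h2 := Nat.cast_ne_zero (R := ℂ).2 n.factorial_ne_zero
    have h3 : (m : ℂ) + 1 ≠ 0 := by exact_mod_cast m.succ_ne_zero
    have h4 : (n : ℂ) + 1 ≠ 0 := by exact_mod_cast n.succ_ne_zero
    push_cast
    field_simp
    ring
  · rw [pPoly_coeff_of_lt m.lt_succ_self]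
    ring
  · rw [pPoly_coeff_of_lt h, pPoly_coeff_of_lt (by omega)]
    ring

/-- The Bessel-type differential equation satisfied by `p_l`. -/
theorem pPoly_ode (l : ℕ) :
    X * derivative (derivative (pPoly l)) =
      2 * ((X + C (l : ℂ)) * derivative (pPoly l) - C (l : ℂ) * pPoly l) := by
  rw [show (2 : ℂ[X]) = C 2 from rfl]
  ext m
  have h := pPoly_coeff_succ l m
  rw [coeff_C_mul, coeff_sub, add_mul, coeff_add, coeff_C_mul, coeff_C_mul]
  cases m with
  | zero =>
    simp only [coeff_X_mul_zero, coeff_derivative]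
    push_cast at h ⊢
    linear_combination -h
  | succ m =>
    simp only [coeff_X_mul, coeff_derivative]
    push_cast at h ⊢
    linear_combination -h

theorem eval_qPoly (l : ℕ) (z : ℂ) : (qPoly l).eval z =
    z * (derivative (pPoly l)).eval z - (z + l) * (pPoly l).eval z := by
  simp [qPoly]

theorem mul_eval_derivative_qPoly {l : ℕ} {z : ℂ} (hz : (qPoly l).IsRoot z) :
    z * (derivative (qPoly l)).eval z =
      (pPoly l).eval z * (z ^ 2 + (l : ℂ) * ((l : ℂ) + 1)) := by
  have h := eval_qPoly l z
  rw [hz.eq_zero] at h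
  have ho := congrArg (eval z) (pPoly_ode l)
  simp only [eval_mul, eval_sub, eval_add, eval_X, eval_C, eval_ofNat] at ho
  simp only [qPoly, derivative_sub, derivative_mul, derivative_add, derivative_X, derivative_C,
    eval_sub, eval_mul, eval_add, eval_X, eval_C, eval_one, eval_zero]
  linear_combination z * ho - (z + l + 1) * h

theorem Polynomial.Monic.eq_nodal_of_isRoot {F ι : Type*} [Field F] [Fintype ι] {p : F[X]}
    (hp : p.Monic) (hdeg : p.natDegree = Fintype.card ι) {v : ι → F}
    (hv : Function.Injective v) (hroot : ∀ i, p.IsRoot (v i)) :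
    p = Lagrange.nodal Finset.univ v := by
  refine eq_of_degree_sub_lt_of_eval_index_eq Finset.univ hv.injOn ?_ fun i hi => ?_
  · have hd : p.degree = (Finset.univ : Finset ι).card := by
      rw [degree_eq_natDegree hp.ne_zero, hdeg, Finset.card_univ]
    rw [← hd]
    exact degree_sub_lt_left (by rw [hd, Lagrange.degree_nodal]) hp.ne_zero
      (by rw [hp.leadingCoeff, Lagrange.nodal_monic.leadingCoeff])
  · rw [(hroot i).eq_zero, Lagrange.eval_nodal_at_node hi]

theorem pPoly_natDegree (l : ℕ) : (pPoly l).natDegree = l :=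
  natDegree_eq_of_le_of_coeff_ne_zero (pPoly_natDegree_le l) (by simp [pPoly_coeff_self])

theorem pPoly_monic (l : ℕ) : (pPoly l).Monic :=
  monic_of_natDegree_le_of_coeff_eq_one l (pPoly_natDegree_le l) (pPoly_coeff_self l)

theorem qPoly_coeff_succ (l m : ℕ) : (qPoly l).coeff (m + 1) =
    ((m : ℂ) + 1 - l) * (pPoly l).coeff (m + 1) - (pPoly l).coeff m := by
  rw [qPoly, coeff_sub, add_mul, coeff_add, coeff_C_mul, coeff_X_mul, coeff_X_mul,
    coeff_derivative]
  ring

theorem neg_qPoly_natDegree_le (l : ℕ) : (-qPoly l).natDegree ≤ l + 1 := by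
  refine natDegree_le_iff_coeff_eq_zero.2 fun m h => ?_
  obtain ⟨m, rfl⟩ : ∃ n, m = n + 1 := ⟨m - 1, by omega⟩
  rw [coeff_neg, qPoly_coeff_succ, pPoly_coeff_of_lt (by omega), pPoly_coeff_of_lt (by omega)]
  simp

theorem neg_qPoly_coeff (l : ℕ) : (-qPoly l).coeff (l + 1) = 1 := by
  rw [coeff_neg, qPoly_coeff_succ, pPoly_coeff_self, pPoly_coeff_of_lt l.lt_succ_self]
  simp

theorem neg_qPoly_monic (l : ℕ) : (-qPoly l).Monic :=
  monic_of_natDegree_le_of_coeff_eq_one (l + 1) (neg_qPoly_natDegree_le l) (neg_qPoly_coeff l)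

theorem neg_qPoly_natDegree (l : ℕ) : (-qPoly l).natDegree = l + 1 :=
  natDegree_eq_of_le_of_coeff_ne_zero (neg_qPoly_natDegree_le l)
    (by rw [neg_qPoly_coeff]; exact one_ne_zero)

theorem sum_eval_mul_nodalWeight {F ι : Type*} [Field F] [Fintype ι] [DecidableEq ι] {v : ι → F}
    (hv : Function.Injective v) {P : F[X]} (hP : P.degree < Fintype.card ι) :
    ∑ i, P.eval (v i) * Lagrange.nodalWeight Finset.univ v i = P.coeff (Fintype.card ι - 1) := by
  rw [← Finset.card_univ, Lagrange.coeff_eq_sum hv.injOn (by rwa [Finset.card_univ])]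
  refine Finset.sum_congr rfl fun i _ => ?_
  rw [Lagrange.nodalWeight, Finset.prod_inv_distrib, div_eq_mul_inv]

theorem eval_eq_nodal_mul_sum {F ι : Type*} [Field F] [Fintype ι] [DecidableEq ι] {v : ι → F}
    (hv : Function.Injective v) {P : F[X]} (hP : P.degree < Fintype.card ι) {x : F}
    (hx : ∀ i, x ≠ v i) :
    P.eval x = (Lagrange.nodal Finset.univ v).eval x *
      ∑ i, Lagrange.nodalWeight Finset.univ v i * (x - v i)⁻¹ * P.eval (v i) := by
  conv_lhs => rw [Lagrange.eq_interpolate (f := P) hv.injOn (s := Finset.univ) (by rwa [Finset.card_univ])]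
  exact Lagrange.eval_interpolate_not_at_node _ fun i _ => hx i

section Roots

variable {l : ℕ} {zp : Fin l → ℂ} {zq : Fin (l + 1) → ℂ}

theorem pPoly_eq_nodal (hinjp : Function.Injective zp) (hrootp : ∀ j, (pPoly l).IsRoot (zp j)) :
    pPoly l = Lagrange.nodal Finset.univ zp :=
  (pPoly_monic l).eq_nodal_of_isRoot (by simp [pPoly_natDegree]) hinjp hrootp

theorem neg_qPoly_eq_nodal (hinjq : Function.Injective zq)
    (hrootq : ∀ j, (qPoly l).IsRoot (zq j)) :
    -qPoly l = Lagrange.nodal Finset.univ zq :=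
  (neg_qPoly_monic l).eq_nodal_of_isRoot
    (by rw [neg_qPoly_natDegree, Fintype.card_fin]) hinjq fun j => by
    simp [(hrootq j).eq_zero]

theorem ne_zero_of_isRoot_qPoly (hl : 1 ≤ l) {z : ℂ} (hz : (qPoly l).IsRoot z) : z ≠ 0 := by
  rintro rfl
  have h := eval_qPoly l 0
  rw [hz.eq_zero] at h
  have hl0 : (l : ℂ) ≠ 0 := Nat.cast_ne_zero.2 (by omega)
  exact mul_ne_zero hl0 (pPoly_eval_zero_ne_zero l) (by linear_combination h)

theorem ne_zero_of_isRoot_pPoly {z : ℂ} (hz : (pPoly l).IsRoot z) : z ≠ 0 := by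
  rintro rfl
  exact pPoly_eval_zero_ne_zero l hz

theorem eval_derivative_pPoly_ne_zero (hinjp : Function.Injective zp)
    (hrootp : ∀ j, (pPoly l).IsRoot (zp j)) (k : Fin l) :
    (derivative (pPoly l)).eval (zp k) ≠ 0 := by
  classical
  rw [pPoly_eq_nodal hinjp hrootp, Lagrange.eval_nodal_derivative_eval_node_eq (Finset.mem_univ k)]
  exact Lagrange.eval_nodal_not_at_node fun i hi => fun h =>
    (Finset.mem_erase.1 hi).1 (hinjp h).symm

theorem eval_derivative_qPoly_ne_zero (hinjq : Function.Injective zq)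
    (hrootq : ∀ j, (qPoly l).IsRoot (zq j)) (j : Fin (l + 1)) :
    (derivative (qPoly l)).eval (zq j) ≠ 0 := by
  classical
  rw [← neg_ne_zero, ← eval_neg, ← derivative_neg, neg_qPoly_eq_nodal hinjq hrootq,
    Lagrange.eval_nodal_derivative_eval_node_eq (Finset.mem_univ j)]
  exact Lagrange.eval_nodal_not_at_node fun i hi => fun h =>
    (Finset.mem_erase.1 hi).1 (hinjq h).symm

theorem eval_qPoly_root_pPoly_ne_zero (hinjp : Function.Injective zp)
    (hrootp : ∀ j, (pPoly l).IsRoot (zp j)) (k : Fin l) : (qPoly l).eval (zp k) ≠ 0 := by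
  rw [eval_qPoly, (hrootp k).eq_zero, mul_zero, sub_zero]
  exact mul_ne_zero (ne_zero_of_isRoot_pPoly (hrootp k))
    (eval_derivative_pPoly_ne_zero hinjp hrootp k)

theorem root_pPoly_ne_root_qPoly (hinjp : Function.Injective zp)
    (hrootp : ∀ j, (pPoly l).IsRoot (zp j)) (hrootq : ∀ j, (qPoly l).IsRoot (zq j))
    (k : Fin l) (j : Fin (l + 1)) : zp k ≠ zq j := fun h =>
  eval_qPoly_root_pPoly_ne_zero hinjp hrootp k (by rw [h]; exact hrootq j)

theorem degree_X_mul_derivative_pPoly_sub_lt (hl : 1 ≤ l) :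
    (X * derivative (pPoly l) - C (l : ℂ) * pPoly l).degree < (l : WithBot ℕ) := by
  rw [degree_lt_iff_coeff_zero]
  intro m hm
  obtain ⟨m, rfl⟩ : ∃ n, m = n + 1 := ⟨m - 1, by omega⟩
  rw [coeff_sub, coeff_X_mul, coeff_C_mul, coeff_derivative]
  rcases hm.eq_or_lt with rfl | h
  · push_cast
    ring
  · rw [pPoly_coeff_of_lt h]
    simp

theorem weight_eq (hl : 1 ≤ l) (hinjq : Function.Injective zq)
    (hrootq : ∀ j, (qPoly l).IsRoot (zq j)) (j : Fin (l + 1)) :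
    zq j ^ 2 / (zq j ^ 2 + (l : ℂ) * ((l : ℂ) + 1)) =
      -((X * derivative (pPoly l) - C (l : ℂ) * pPoly l).eval (zq j) *
        Lagrange.nodalWeight Finset.univ zq j) := by
  have hq := eval_derivative_qPoly_ne_zero hinjq hrootq j
  have hz := ne_zero_of_isRoot_qPoly hl (hrootq j)
  have hm := mul_eval_derivative_qPoly (hrootq j)
  have hD := right_ne_zero_of_mul (hm ▸ mul_ne_zero hz hq)
  have h := eval_qPoly l (zq j)
  rw [(hrootq j).eq_zero] at h
  rw [Lagrange.nodalWeight_eq_eval_derivative_nodal (Finset.mem_univ j),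
    ← neg_qPoly_eq_nodal hinjq hrootq]
  simp only [derivative_neg, eval_neg, eval_sub, eval_mul, eval_X, eval_C]
  rw [inv_neg, mul_neg, neg_neg, ← div_eq_mul_inv, div_eq_div_iff hD hq]
  linear_combination zq j * hm + (zq j ^ 2 + (l : ℂ) * ((l : ℂ) + 1)) * h

theorem sum_weight (hl : 1 ≤ l) (hinjq : Function.Injective zq)
    (hrootq : ∀ j, (qPoly l).IsRoot (zq j)) :
    ∑ j, zq j ^ 2 / (zq j ^ 2 + (l : ℂ) * ((l : ℂ) + 1)) = 0 := by
  have hd := degree_X_mul_derivative_pPoly_sub_lt hl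
  simp only [weight_eq hl hinjq hrootq]
  rw [Finset.sum_neg_distrib, sum_eval_mul_nodalWeight hinjq
    (hd.trans (by rw [Fintype.card_fin]; exact_mod_cast l.lt_succ_self)), Fintype.card_fin,
    Nat.add_sub_cancel, coeff_eq_zero_of_degree_lt hd, neg_zero]

theorem sum_weight_mul_root (hl : 1 ≤ l) (hinjp : Function.Injective zp)
    (hrootp : ∀ j, (pPoly l).IsRoot (zp j)) (hinjq : Function.Injective zq)
    (hrootq : ∀ j, (qPoly l).IsRoot (zq j)) :
    ∑ j, zq j ^ 2 / (zq j ^ 2 + (l : ℂ) * ((l : ℂ) + 1)) * zq j = -∑ k, zp k := by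
  have hd := degree_X_mul_derivative_pPoly_sub_lt hl
  set f := X * derivative (pPoly l) - C (l : ℂ) * pPoly l with hf
  have hXf : (X * f).degree < (Fintype.card (Fin (l + 1)) : WithBot ℕ) := by
    rw [Fintype.card_fin, degree_lt_iff_coeff_zero]
    intro m hm
    obtain ⟨m, rfl⟩ : ∃ n, m = n + 1 := ⟨m - 1, by omega⟩
    rw [coeff_X_mul]
    exact coeff_eq_zero_of_degree_lt (hd.trans_le (by exact_mod_cast Nat.le_of_succ_le_succ hm))
  have hs := sum_eval_mul_nodalWeight hinjq hXf
  have he : (pPoly l).coeff (l - 1) = -∑ k, zp k := by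
    rw [← prod_X_sub_C_nextCoeff, ← Lagrange.nodal_eq, ← pPoly_eq_nodal hinjp hrootp,
      nextCoeff_of_natDegree_pos (by rw [pPoly_natDegree]; omega), pPoly_natDegree]
  have hc : (X * f).coeff l = ∑ k, zp k := by
    obtain ⟨m, rfl⟩ : ∃ n, l = n + 1 := ⟨l - 1, by omega⟩
    rw [coeff_X_mul, hf, coeff_sub, coeff_C_mul]
    rw [Nat.add_sub_cancel] at he
    rw [he]
    cases m with
    | zero =>
      rw [coeff_X_mul_zero]
      push_cast
      ring
    | succ m =>
      rw [coeff_X_mul, coeff_derivative, he]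
      push_cast
      ring
  rw [Fintype.card_fin, Nat.add_sub_cancel, hc] at hs
  rw [← hs, ← Finset.sum_neg_distrib]
  refine Finset.sum_congr rfl fun j _ => ?_
  rw [weight_eq hl hinjq hrootq, eval_mul, eval_X]
  ring

theorem sum_weight_div_sub (hl : 1 ≤ l) (hinjp : Function.Injective zp)
    (hrootp : ∀ j, (pPoly l).IsRoot (zp j)) (hinjq : Function.Injective zq)
    (hrootq : ∀ j, (qPoly l).IsRoot (zq j)) (k : Fin l) :
    ∑ j, zq j ^ 2 / (zq j ^ 2 + (l : ℂ) * ((l : ℂ) + 1)) / (zp k - zq j) = 1 := by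
  have hd := degree_X_mul_derivative_pPoly_sub_lt hl
  have h := eval_eq_nodal_mul_sum hinjq
    (hd.trans (by rw [Fintype.card_fin]; exact_mod_cast l.lt_succ_self))
    (root_pPoly_ne_root_qPoly hinjp hrootp hrootq k)
  have hq := eval_qPoly l (zp k)
  have hne := eval_qPoly_root_pPoly_ne_zero hinjp hrootp k
  simp only [weight_eq hl hinjq hrootq]
  rw [← neg_qPoly_eq_nodal hinjq hrootq, eval_sub, eval_mul, eval_mul, eval_X, eval_C,
    (hrootp k).eq_zero, mul_zero, sub_zero] at h
  rw [(hrootp k).eq_zero, mul_zero, sub_zero] at hq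
  rw [← hq, eval_neg, neg_mul, ← mul_neg, ← Finset.sum_neg_distrib] at h
  refine Eq.trans ?_ (mul_left_cancel₀ hne ((mul_one _).trans h)).symm
  refine Finset.sum_congr rfl fun j _ => ?_
  rw [div_eq_mul_inv]
  ring

theorem sum_root_div_sub (hinjp : Function.Injective zp)
    (hrootp : ∀ j, (pPoly l).IsRoot (zp j)) {z : ℂ} (hz : (qPoly l).IsRoot z) :
    ∑ k, zp k / (zp k - z) = -z := by
  classical
  have hne : ∀ k, z ≠ zp k := fun k h =>
    eval_qPoly_root_pPoly_ne_zero hinjp hrootp k (h ▸ hz)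
  have hp := pPoly_eq_nodal hinjp hrootp
  have hp0 : (pPoly l).eval z ≠ 0 := by
    rw [hp]
    exact Lagrange.eval_nodal_not_at_node fun k _ => hne k
  have hderiv : (derivative (pPoly l)).eval z = (pPoly l).eval z * ∑ k, (z - zp k)⁻¹ := by
    rw [hp, Lagrange.derivative_nodal, eval_finsetSum, Finset.mul_sum]
    refine Finset.sum_congr rfl fun k _ => ?_
    rw [Lagrange.nodal_eq_mul_nodal_erase (Finset.mem_univ k), eval_mul, eval_sub, eval_X, eval_C,
      mul_right_comm, mul_inv_cancel₀ (sub_ne_zero.2 (hne k)), one_mul]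
  have hq := eval_qPoly l z
  rw [hz.eq_zero, hderiv] at hq
  have hs : z * ∑ k, (z - zp k)⁻¹ = z + l :=
    mul_left_cancel₀ hp0 (by linear_combination -hq)
  have ht : ∀ k, zp k / (zp k - z) = 1 - z * (z - zp k)⁻¹ := fun k => by
    have h1 := sub_ne_zero.2 (hne k)
    have h2 := sub_ne_zero.2 (hne k).symm
    field_simp
    ring
  simp only [ht]
  rw [Finset.sum_sub_distrib, ← Finset.mul_sum, hs]
  simp

end Roots

/-- The convolution `∫₀^t e^{κ(t-τ)} f(τ) dτ`. -/
noncomputable def expConv (κ : ℂ) (f : ℝ → ℂ) (t : ℝ) : ℂ :=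
  ∫ τ in (0 : ℝ)..t, Complex.exp (κ * ((t : ℂ) - τ)) * f τ

theorem expConv_zero (κ : ℂ) (f : ℝ → ℂ) : expConv κ f 0 = 0 := integral_same

theorem expConv_congr {κ : ℂ} {f g : ℝ → ℂ} {t : ℝ} (ht : 0 ≤ t)
    (h : ∀ s, 0 ≤ s → f s = g s) : expConv κ f t = expConv κ g t := by
  refine integral_congr fun s hs => ?_
  rw [Set.uIcc_of_le ht] at hs
  simp only [h s hs.1]

theorem expConv_eq_exp_mul (κ : ℂ) (f : ℝ → ℂ) (t : ℝ) :
    expConv κ f t = Complex.exp (κ * t) * ∫ τ in (0 : ℝ)..t, Complex.exp (-(κ * τ)) * f τ := by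
  rw [expConv, ← integral_const_mul]
  refine integral_congr fun s _ => ?_
  simp only [← mul_assoc, ← Complex.exp_add]
  ring_nf

theorem hasDerivAt_exp_mul_ofReal (κ : ℂ) (t : ℝ) :
    HasDerivAt (fun s : ℝ => Complex.exp (κ * s)) (Complex.exp (κ * t) * κ) t := by
  simpa using ((hasDerivAt_id t).ofReal_comp.const_mul κ).cexp

theorem hasDerivAt_expConv (κ : ℂ) {f : ℝ → ℂ} (hf : Continuous f) (t : ℝ) :
    HasDerivAt (expConv κ f) (κ * expConv κ f t + f t) t := by
  have h1 : Continuous fun τ : ℝ => Complex.exp (-(κ * τ)) * f τ := by fun_prop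
  have h2 := (hasDerivAt_exp_mul_ofReal κ t).mul (h1.integral_hasStrictDerivAt 0 t).hasDerivAt
  rw [funext (expConv_eq_exp_mul κ f)]
  refine h2.congr_deriv ?_
  have h3 : Complex.exp (κ * t) * Complex.exp (-(κ * t)) = 1 := by
    rw [← Complex.exp_add, add_neg_cancel, Complex.exp_zero]
  linear_combination f t * h3

theorem continuous_expConv (κ : ℂ) {f : ℝ → ℂ} (hf : Continuous f) : Continuous (expConv κ f) :=
  continuous_iff_continuousAt.2 fun t => (hasDerivAt_expConv κ hf t).continuousAt

/-- Variation of constants: `expConv κ h` is the only solution of `F' = κ F + h`, `F 0 = 0`. -/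
theorem expConv_eq_of_hasDerivAt {κ : ℂ} {F h : ℝ → ℂ} (hh : Continuous h) (hF0 : F 0 = 0)
    (hF : ∀ t, HasDerivAt F (κ * F t + h t) t) (t : ℝ) : expConv κ h t = F t := by
  have hd : ∀ s : ℝ, HasDerivAt (fun s : ℝ => Complex.exp (-κ * s) * F s)
      (Complex.exp (-(κ * s)) * h s) s := fun s =>
    ((hasDerivAt_exp_mul_ofReal (-κ) s).mul (hF s)).congr_deriv (by rw [neg_mul]; ring)
  have hc : Continuous fun τ : ℝ => Complex.exp (-(κ * τ)) * h τ := by fun_prop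
  rw [expConv_eq_exp_mul, integral_eq_sub_of_hasDerivAt (fun s _ => hd s)
    (hc.intervalIntegrable 0 t), hF0, mul_zero, sub_zero, ← mul_assoc, ← Complex.exp_add]
  simp

theorem expConv_deriv (κ : ℂ) {f f' : ℝ → ℂ} (hf : ∀ t, HasDerivAt f (f' t) t)
    (hf' : Continuous f') (hf0 : f 0 = 0) (t : ℝ) :
    expConv κ f' t = f t + κ * expConv κ f t := by
  have hfc : Continuous f := continuous_iff_continuousAt.2 fun t => (hf t).continuousAt
  refine expConv_eq_of_hasDerivAt (F := fun t => f t + κ * expConv κ f t) hf' ?_ (fun s => ?_) t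
  · simp [hf0, expConv_zero]
  · exact ((hf s).add ((hasDerivAt_expConv κ hfc s).const_mul κ)).congr_deriv (by ring)

theorem sub_mul_expConv_expConv (κ μ : ℂ) {f : ℝ → ℂ} (hf : Continuous f) (t : ℝ) :
    expConv κ (fun s => (μ - κ) * expConv μ f s) t = expConv μ f t - expConv κ f t := by
  refine expConv_eq_of_hasDerivAt (F := fun t => expConv μ f t - expConv κ f t)
    (h := fun s => (μ - κ) * expConv μ f s) (continuous_const.mul (continuous_expConv μ hf)) ?_ (fun s => ?_) t
  · simp [expConv_zero]
  · exact ((hasDerivAt_expConv μ hf s).sub (hasDerivAt_expConv κ hf s)).congr_deriv (by ring)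

theorem expConv_const_mul (κ r : ℂ) (f : ℝ → ℂ) (t : ℝ) :
    expConv κ (fun s => r * f s) t = r * expConv κ f t := by
  simp only [expConv, ← integral_const_mul, mul_left_comm]

theorem expConv_expConv {κ μ : ℂ} (h : μ ≠ κ) {f : ℝ → ℂ} (hf : Continuous f) (t : ℝ) :
    expConv κ (expConv μ f) t = (expConv μ f t - expConv κ f t) / (μ - κ) := by
  rw [← sub_mul_expConv_expConv κ μ hf, expConv_const_mul,
    mul_div_cancel_left₀ _ (sub_ne_zero.2 h)]

theorem expConv_sub (κ : ℂ) {f g : ℝ → ℂ} (hf : Continuous f) (hg : Continuous g) (t : ℝ) :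
    expConv κ (fun s => f s - g s) t = expConv κ f t - expConv κ g t := by
  simp only [expConv, mul_sub]
  exact integral_sub (Continuous.intervalIntegrable (by fun_prop) _ _)
    (Continuous.intervalIntegrable (by fun_prop) _ _)

theorem expConv_sum {ι : Type*} (s : Finset ι) (κ : ℂ) {f : ι → ℝ → ℂ}
    (hf : ∀ i, Continuous (f i)) (t : ℝ) :
    expConv κ (fun x => ∑ i ∈ s, f i x) t = ∑ i ∈ s, expConv κ (f i) t := by
  simp only [expConv, Finset.mul_sum]
  exact integral_finsetSum fun i _ =>
    Continuous.intervalIntegrable (by have := hf i; fun_prop) _ _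

/-- The convolution of a finite sum of exponentials with `f`. -/
theorem integral_sum_exp_mul_comp_sub {ι : Type*} [Fintype ι] (a : ℂ) (z : ι → ℂ) {f : ℝ → ℂ}
    (hf : Continuous f) (t : ℝ) :
    (∫ τ in (0 : ℝ)..t, a * (∑ j, z j * Complex.exp (a * z j * τ)) * f (t - τ)) =
      a * ∑ j, z j * expConv (a * z j) f t := by
  have h := integral_comp_sub_left (a := 0) (b := t)
    (fun τ : ℝ => a * (∑ j, z j * Complex.exp (a * z j * ((t : ℂ) - τ))) * f τ) t
  simp only [sub_self, sub_zero, Complex.ofReal_sub, sub_sub_cancel] at h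
  rw [h]
  simp only [expConv, mul_assoc, integral_const_mul, Finset.sum_mul]
  rw [integral_finsetSum fun i _ => Continuous.intervalIntegrable (by fun_prop) _ _]
  simp only [integral_const_mul]

/-- A `C¹` function on `[0, ∞)` vanishing at `0` extends to a `C¹` function on `ℝ`. -/
theorem exists_hasDerivAt_extension {φ φ' : ℝ → ℂ}
    (hderiv : ∀ t ∈ Set.Ici (0 : ℝ), HasDerivWithinAt φ (φ' t) (Set.Ici (0 : ℝ)) t)
    (hcont : ContinuousOn φ' (Set.Ici (0 : ℝ))) (hφ0 : φ 0 = 0) :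
    ∃ f f' : ℝ → ℂ, (∀ t, HasDerivAt f (f' t) t) ∧ Continuous f' ∧
      (∀ t, 0 ≤ t → f t = φ t) ∧ ∀ t, 0 ≤ t → f' t = φ' t := by
  have hc : Continuous fun t : ℝ => φ' (max t 0) :=
    hcont.comp_continuous (by fun_prop) fun t => le_max_right t 0
  refine ⟨fun t => ∫ s in (0 : ℝ)..t, φ' (max s 0), _,
    fun t => (hc.integral_hasStrictDerivAt 0 t).hasDerivAt, hc, fun t ht => ?_,
    fun t ht => by rw [max_eq_left ht]⟩
  have h := integral_eq_sub_of_hasDerivAt_of_le (f := φ) ht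
    (fun s hs => ((hderiv s hs.1).continuousWithinAt).mono fun _ h => h.1)
    (fun s hs => by
      rw [max_eq_left hs.1.le]
      exact (hderiv s hs.1.le).hasDerivAt (Ici_mem_nhds hs.1))
    (hc.intervalIntegrable 0 t)
  exact h.trans (by rw [hφ0, sub_zero])

/-- Time-domain identity `(ρ_l ∗ ψ_l)(t) = (σ_l ∗ φ′)(t)` used to validate the analytic
formula for the NRBC kernel `ρ_l` against the known kernel `σ_l`: with
`σ_l(t) = (c/b) ∑_j z_j e^{(c/b)z_j t}` and `ψ(t) = (σ_l ∗ φ)(t) − (b/c) φ′(t)`, where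
`{z_j}` are the roots of `p_l`, `{z̃_j}` are the roots of `q_l` and `β_l = l(l+1)`, one has
`(c/b) ∑_j (z̃_j³/(z̃_j²+β_l)) ∫₀^t e^{(c/b)z̃_j(t−τ)} ψ(τ) dτ + ψ(t) ∑_j z̃_j²/(z̃_j²+β_l)
  = ∑_j z_j ∫₀^t e^{(c/b)z_j(t−τ)} φ′(τ) dτ` for all `t ≥ 0`. -/
theorem rho_sigma_convolution_identity (l : ℕ) (hl : 1 ≤ l) (b c : ℝ)
    (hb : 0 < b) (hc : 0 < c)
    (zp : Fin l → ℂ) (hinjp : Function.Injective zp)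
    (hrootp : ∀ j, (pPoly l).IsRoot (zp j))
    (zq : Fin (l + 1) → ℂ) (hinjq : Function.Injective zq)
    (hrootq : ∀ j, (qPoly l).IsRoot (zq j))
    (φ φ' : ℝ → ℂ)
    (hderiv : ∀ t ∈ Set.Ici (0 : ℝ), HasDerivWithinAt φ (φ' t) (Set.Ici (0 : ℝ)) t)
    (hcont : ContinuousOn φ' (Set.Ici (0 : ℝ))) (hφ0 : φ 0 = 0)
    (σ ψ : ℝ → ℂ)
    (hσ : ∀ t : ℝ, σ t = (c / b : ℂ) * ∑ j, zp j * Complex.exp ((c / b : ℂ) * zp j * t))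
    (hψ : ∀ t : ℝ, ψ t = (∫ τ in (0 : ℝ)..t, σ τ * φ (t - τ)) - (b / c : ℂ) * φ' t) :
    ∀ t ≥ (0 : ℝ),
      (c / b : ℂ) *
          (∑ j, (zq j) ^ 3 / ((zq j) ^ 2 + (l : ℂ) * ((l : ℂ) + 1)) *
            ∫ τ in (0 : ℝ)..t, Complex.exp ((c / b : ℂ) * zq j * ((t : ℂ) - τ)) * ψ τ)
        + ψ t * ∑ j, (zq j) ^ 2 / ((zq j) ^ 2 + (l : ℂ) * ((l : ℂ) + 1))
      = ∑ j, zp j *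
          ∫ τ in (0 : ℝ)..t, Complex.exp ((c / b : ℂ) * zp j * ((t : ℂ) - τ)) * φ' τ := by
  intro t ht
  obtain ⟨f, f', hf, hf'c, hfφ, hfφ'⟩ := exists_hasDerivAt_extension hderiv hcont hφ0
  have hfc : Continuous f := continuous_iff_continuousAt.2 fun t => (hf t).continuousAt
  have hf0 : f 0 = 0 := (hfφ 0 le_rfl).trans hφ0
  have ha : (c / b : ℂ) ≠ 0 :=
    div_ne_zero (Complex.ofReal_ne_zero.2 hc.ne') (Complex.ofReal_ne_zero.2 hb.ne')
  have hai : (b / c : ℂ) = (c / b : ℂ)⁻¹ := (inv_div _ _).symm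
  rw [hai] at hψ
  generalize (c / b : ℂ) = a at *
  have hψ' : ∀ s, 0 ≤ s → ψ s = a * ∑ k, zp k * expConv (a * zp k) f s - a⁻¹ * f' s := by
    intro s hs
    rw [hψ, hfφ' s hs, ← integral_sum_exp_mul_comp_sub a zp hfc]
    congr 1
    refine integral_congr fun τ hτ => ?_
    rw [Set.uIcc_of_le hs] at hτ
    simp only [hσ, hfφ _ (sub_nonneg.2 hτ.2)]
  have hconv : ∀ j, expConv (a * zq j) ψ t =
      ∑ k, zp k / (zp k - zq j) * expConv (a * zp k) f t - a⁻¹ * f t := by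
    intro j
    have hcE := fun k => continuous_expConv (a * zp k) hfc
    rw [expConv_congr ht hψ', expConv_sub _ (by fun_prop) (by fun_prop), expConv_const_mul,
      expConv_const_mul, expConv_sum _ _ (fun k => by have := hcE k; fun_prop),
      expConv_deriv _ hf hf'c hf0]
    have hterm : ∀ k, expConv (a * zq j) (fun s => zp k * expConv (a * zp k) f s) t =
        a⁻¹ * (zp k / (zp k - zq j) * expConv (a * zp k) f t) -
          a⁻¹ * (zp k / (zp k - zq j) * expConv (a * zq j) f t) := by
      intro k
      have hne := root_pPoly_ne_root_qPoly hinjp hrootp hrootq k j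
      have hne' := sub_ne_zero.2 hne
      rw [expConv_const_mul, expConv_expConv (fun h => hne (mul_left_cancel₀ ha h)) hfc,
        ← mul_sub]
      field_simp
    simp only [hterm]
    rw [Finset.sum_sub_distrib, ← Finset.mul_sum, ← Finset.mul_sum, ← Finset.sum_mul,
      sum_root_div_sub hinjp hrootp (hrootq j)]
    field_simp
    ring
  have hR : ∀ k, expConv (a * zp k) φ' t = f t + a * zp k * expConv (a * zp k) f t := fun k => by
    rw [← expConv_congr ht hfφ', expConv_deriv _ hf hf'c hf0]
  rw [sum_weight hl hinjq hrootq, mul_zero, add_zero]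
  change a * ∑ j, zq j ^ 3 / (zq j ^ 2 + (l : ℂ) * ((l : ℂ) + 1)) * expConv (a * zq j) ψ t =
    ∑ k, zp k * expConv (a * zp k) φ' t
  have hw0 := sum_weight hl hinjq hrootq
  have hw1 := sum_weight_mul_root hl hinjp hrootp hinjq hrootq
  have hw2 := sum_weight_div_sub hl hinjp hrootp hinjq hrootq
  have hpow : ∀ j, zq j ^ 3 / (zq j ^ 2 + (l : ℂ) * ((l : ℂ) + 1)) =
      zq j ^ 2 / (zq j ^ 2 + (l : ℂ) * ((l : ℂ) + 1)) * zq j := fun j => by ring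
  simp only [hconv, hR, hpow]
  generalize hw : (fun j => zq j ^ 2 / (zq j ^ 2 + (l : ℂ) * ((l : ℂ) + 1))) = w
  have hwj : ∀ j, zq j ^ 2 / (zq j ^ 2 + (l : ℂ) * ((l : ℂ) + 1)) = w j := fun j => congrFun hw j
  simp only [hwj] at hw0 hw1 hw2 ⊢
  have hk : ∀ k, ∑ j, w j * zq j * (zp k / (zp k - zq j) * expConv (a * zp k) f t) =
      zp k * (zp k * expConv (a * zp k) f t) := by
    intro k
    have hj : ∀ j, w j * zq j * (zp k / (zp k - zq j) * expConv (a * zp k) f t) =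
        zp k * expConv (a * zp k) f t * (zp k * (w j / (zp k - zq j)) - w j) := by
      intro j
      have := sub_ne_zero.2 (root_pPoly_ne_root_qPoly hinjp hrootp hrootq k j)
      field_simp
      ring
    simp only [hj]
    rw [← Finset.mul_sum, Finset.sum_sub_distrib, ← Finset.mul_sum, hw2, hw0]
    ring
  simp only [mul_sub, Finset.mul_sum (s := (Finset.univ : Finset (Fin l))),
    Finset.sum_sub_distrib]
  rw [Finset.sum_comm, ← Finset.sum_mul, hw1]
  simp only [hk, mul_add, Finset.sum_add_distrib, ← Finset.sum_mul]
  have hI : ∑ k, zp k * (a * zp k * expConv (a * zp k) f t) =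
      a * ∑ k, zp k * (zp k * expConv (a * zp k) f t) := by
    rw [Finset.mul_sum]
    exact Finset.sum_congr rfl fun k _ => by ring
  rw [hI]
  linear_combination (∑ k, zp k) * f t * mul_inv_cancel₀ ha
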